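/- Let Δ ≥ 4 be an integer, let real numbers c_1, …, c_Δ satisfy c_Δ = 1/Δ and i·c_i + c_{i+1} = 1 for i = 1, …, Δ−1, and let G be a finite connected simple graph with maximum degree Δ′, where 3 ≤ Δ′ < Δ, not isomorphic to K_{Δ′+1}. Then α(G) ≥ Σ_{i=1}^{Δ′} c_i·|V_i(G)|. -/

import Mathlib

/-- A set of vertices is independent if its elements are pairwise nonadjacent. -/
def IsIndepSet {V : Type*} (G : SimpleGraph V) (s : Set V) : Prop :=
  s.Pairwise fun a b => ¬ G.Adj a b

/-- The independence number: the largest cardinality of an independent set of vertices. -/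
noncomputable def indepNum {V : Type*} [Fintype V] (G : SimpleGraph V) : ℕ :=
  sSup {n | ∃ s : Finset V, IsIndepSet G ↑s ∧ s.card = n}

open Finset in
/-- Greedy selection: if in every nonempty subset of `S` some closed neighbourhood has weight at
most one, then `S` contains an independent set at least as large as the weight of `S`. -/
theorem exists_isIndepSet_of_closedNeighborhood_weight_le {V : Type*} [DecidableEq V]
    (G : SimpleGraph V) [DecidableRel G.Adj] (w : V → ℝ) (S : Finset V)
    (h : ∀ R ⊆ S, R.Nonempty → ∃ v ∈ R, ∑ u ∈ R with u = v ∨ G.Adj v u, w u ≤ 1) :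
    ∃ T ⊆ S, IsIndepSet G (T : Set V) ∧ ∑ v ∈ S, w v ≤ (#T : ℝ) := by
  induction S using Finset.strongInduction with
  | H S ih =>
    rcases S.eq_empty_or_nonempty with rfl | hS
    · exact ⟨∅, Subset.rfl, by simp [IsIndepSet], by simp⟩
    obtain ⟨v, hv, hsum⟩ := h S Subset.rfl hS
    have hsub : S.filter (fun u => ¬ (u = v ∨ G.Adj v u)) ⊂ S :=
      filter_ssubset.2 ⟨v, hv, by simp⟩
    obtain ⟨T, hTS, hT, hcard⟩ := ih _ hsub fun R hR => h R (hR.trans hsub.subset)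
    have hTv : ∀ u ∈ T, ¬ (u = v ∨ G.Adj v u) := fun u hu => (mem_filter.1 (hTS hu)).2
    have hvT : v ∉ T := fun hvT => hTv v hvT (Or.inl rfl)
    refine ⟨insert v T, insert_subset hv (hTS.trans hsub.subset), ?_, ?_⟩
    · rw [coe_insert]
      refine Set.Pairwise.insert hT fun u hu _ => ⟨fun huv => ?_, fun huv => ?_⟩
      · exact hTv u hu (Or.inr huv)
      · exact hTv u hu (Or.inr huv.symm)
    · rw [card_insert_of_notMem hvT, ← sum_filter_add_sum_filter_not S (fun u => u = v ∨ G.Adj v u)]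
      push_cast
      linarith

/-- In a connected graph, a nonempty set of vertices closed under adjacency contains everything. -/
theorem SimpleGraph.Connected.forall_of_adj {V : Type*} {G : SimpleGraph V} (hG : G.Connected)
    {P : V → Prop} (hP : ∀ u v, G.Adj u v → P u → P v) {u : V} (hu : P u) (v : V) : P v := by
  obtain ⟨p⟩ := hG.preconnected u v
  induction p with
  | nil => exact hu
  | cons hadj _ ih => exact ih (hP _ _ hadj hu)

theorem card_le_indepNum {V : Type*} [Fintype V] {G : SimpleGraph V} {T : Finset V}
    (hT : IsIndepSet G (T : Set V)) : T.card ≤ indepNum G := by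
  refine le_csSup ⟨Fintype.card V, ?_⟩ ⟨T, hT, rfl⟩
  rintro n ⟨s, -, rfl⟩
  exact s.card_le_univ

/-- The closed neighbourhood of `v` within `R` has one more element than the neighbourhood. -/
theorem card_closedNeighborhood_filter {V : Type*} [DecidableEq V] (G : SimpleGraph V)
    [DecidableRel G.Adj] {R : Finset V} {v : V} (hv : v ∈ R) :
    (R.filter fun u => u = v ∨ G.Adj v u).card = (R.filter (G.Adj v)).card + 1 := by
  have : (R.filter fun u => u = v ∨ G.Adj v u) = insert v (R.filter (G.Adj v)) := by
    ext u
    simp only [Finset.mem_filter, Finset.mem_insert]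
    constructor
    · tauto
    · rintro (rfl | h)
      · exact ⟨hv, Or.inl rfl⟩
      · exact ⟨h.1, Or.inr h.2⟩
  rw [this, Finset.card_insert_of_notMem (by simp)]

theorem filter_adj_subset_neighborFinset {V : Type*} [Fintype V] (G : SimpleGraph V)
    [DecidableRel G.Adj] (R : Finset V) (v : V) : R.filter (G.Adj v) ⊆ G.neighborFinset v := by
  intro u hu
  simpa using (Finset.mem_filter.1 hu).2

/-- The independence number of a connected `d`-regular graph on `n ≥ d + 1` vertices is at least
`(n - 1) / d`. -/
theorem card_sub_one_le_mul_indepNum {V : Type*} [Fintype V] [DecidableEq V] (G : SimpleGraph V)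
    [DecidableRel G.Adj] (hG : G.Connected) {d : ℕ} (hd : 1 ≤ d)
    (hreg : G.IsRegularOfDegree d) :
    (Fintype.card V : ℝ) - 1 ≤ d * (indepNum G : ℝ) := by
  have hd0 : (0 : ℝ) < d := by exact_mod_cast hd
  obtain ⟨v⟩ := hG.nonempty
  have hcN := card_closedNeighborhood_filter G (Finset.mem_univ v)
  rw [← G.neighborFinset_eq_filter, G.card_neighborFinset_eq_degree, hreg v] at hcN
  set S : Finset V := Finset.univ.filter fun u => ¬ (u = v ∨ G.Adj v u) with hS
  obtain ⟨T, hTS, hT, hcard⟩ :=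
    exists_isIndepSet_of_closedNeighborhood_weight_le G (fun _ => 1 / (d : ℝ)) S (by
      intro R hRS hR
      have hvR : v ∉ R := fun h => (Finset.mem_filter.1 (hRS h)).2 (Or.inl rfl)
      obtain ⟨x, hxR, y, hxy, hyR⟩ : ∃ x ∈ R, ∃ y, G.Adj x y ∧ y ∉ R := by
        by_contra! hcon
        obtain ⟨x, hx⟩ := hR
        exact hvR (hG.forall_of_adj (P := (· ∈ R)) (fun a b hab ha => hcon a ha b hab) hx v)
      refine ⟨x, hxR, ?_⟩
      have hlt : (R.filter (G.Adj x)).card < d := by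
        rw [← hreg x, ← G.card_neighborFinset_eq_degree]
        refine Finset.card_lt_card ⟨filter_adj_subset_neighborFinset G R x, fun h => hyR ?_⟩
        exact (Finset.mem_filter.1 (h ((G.mem_neighborFinset x y).2 hxy))).1
      rw [Finset.sum_const, card_closedNeighborhood_filter G hxR, nsmul_eq_mul, mul_one_div,
        div_le_one hd0]
      exact_mod_cast hlt)
  have hvT : v ∉ T := fun h => (Finset.mem_filter.1 (hTS h)).2 (Or.inl rfl)
  have hindep : IsIndepSet G ((insert v T : Finset V) : Set V) := by
    rw [Finset.coe_insert]
    refine Set.Pairwise.insert hT fun u hu _ => ⟨fun huv => ?_, fun huv => ?_⟩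
    · exact (Finset.mem_filter.1 (hTS hu)).2 (Or.inr huv)
    · exact (Finset.mem_filter.1 (hTS hu)).2 (Or.inr huv.symm)
  have hle := card_le_indepNum hindep
  rw [Finset.card_insert_of_notMem hvT] at hle
  have hle' : (T.card : ℝ) + 1 ≤ indepNum G := by exact_mod_cast hle
  have hsplit := Finset.card_filter_add_card_filter_not (s := (Finset.univ : Finset V))
    (fun u => u = v ∨ G.Adj v u)
  rw [hcN, ← hS, Finset.card_univ] at hsplit
  have hsplit' : (d : ℝ) + 1 + S.card = Fintype.card V := by exact_mod_cast hsplit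
  rw [Finset.sum_const, nsmul_eq_mul, mul_one_div, div_le_iff₀ hd0] at hcard
  nlinarith

/-- Coefficients decreasing from `c 1 ≤ 1` with `i * c i + c (i + 1) ≤ 1` give a lower bound on
the independence number of every connected graph that is not regular. -/
theorem sum_degree_weight_le_indepNum {V : Type*} [Fintype V] [DecidableEq V] (G : SimpleGraph V)
    [DecidableRel G.Adj] (hG : G.Connected) {D : ℕ} (hdeg1 : ∀ v, 1 ≤ G.degree v)
    (hdegD : ∀ v, G.degree v ≤ D) (hreg : ∀ d, ¬ G.IsRegularOfDegree d) (c : ℕ → ℝ)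
    (hc1 : c 1 ≤ 1) (hanti : ∀ i j, 1 ≤ i → i ≤ j → j ≤ D → c j ≤ c i)
    (hrec : ∀ i, 1 ≤ i → i < D → i * c i + c (i + 1) ≤ 1) :
    ∑ v, c (G.degree v) ≤ (indepNum G : ℝ) := by
  obtain ⟨T, -, hT, hcard⟩ :=
    exists_isIndepSet_of_closedNeighborhood_weight_le G (fun v => c (G.degree v)) Finset.univ (by
      intro R _ hR
      have hRdeg : ∀ v, (R.filter (G.Adj v)).card ≤ G.degree v := fun v =>
        (Finset.card_le_card (filter_adj_subset_neighborFinset G R v)).trans_eq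
          (G.card_neighborFinset_eq_degree v)
      obtain ⟨x, hxR, hx⟩ := R.exists_min_image (fun v => (R.filter (G.Adj v)).card) hR
      set i := (R.filter (G.Adj x)).card with hi
      by_contra! hcon
      have hmem : ∀ v ∈ R, (R.filter (G.Adj v)).card = i →
          ∀ u ∈ R, (u = v ∨ G.Adj v u) → G.degree u = i := by
        intro v hv hvi u hu huv
        by_contra hne
        have hui : i < G.degree u := lt_of_le_of_ne ((hx u hu).trans (hRdeg u)) (Ne.symm hne)
        refine absurd (hcon v hv) (not_lt.2 ?_)
        have huN : u ∈ R.filter fun u => u = v ∨ G.Adj v u := Finset.mem_filter.2 ⟨hu, huv⟩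
        rcases Nat.eq_zero_or_pos i with h0 | hpos
        · have hc := card_closedNeighborhood_filter G hv
          rw [hvi, h0, zero_add, Finset.card_eq_one] at hc
          obtain ⟨a, ha⟩ := hc
          rw [ha, Finset.sum_singleton]
          exact (hanti 1 _ le_rfl (hdeg1 a) (hdegD a)).trans hc1
        · rw [← Finset.add_sum_erase _ _ huN]
          have hrest : ∑ a ∈ (R.filter fun u => u = v ∨ G.Adj v u).erase u, c (G.degree a)
              ≤ ((R.filter fun u => u = v ∨ G.Adj v u).erase u).card • c i := by
            refine Finset.sum_le_card_nsmul _ _ _ fun a ha => ?_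
            have haR := (Finset.mem_filter.1 (Finset.mem_of_mem_erase ha)).1
            exact hanti i _ hpos ((hx a haR).trans (hRdeg a)) (hdegD a)
          rw [Finset.card_erase_of_mem huN, card_closedNeighborhood_filter G hv, hvi,
            Nat.add_sub_cancel, nsmul_eq_mul] at hrest
          have := hanti (i + 1) _ (by omega) hui (hdegD u)
          have := hrec i hpos (hui.trans_le (hdegD u))
          linarith
      have hall := hG.forall_of_adj (P := fun v => v ∈ R ∧ (R.filter (G.Adj v)).card = i) (by
        rintro v u hvu ⟨hv, hvi⟩
        have heq := Finset.eq_of_subset_of_card_le (filter_adj_subset_neighborFinset G R v) (by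
          rw [G.card_neighborFinset_eq_degree, hmem v hv hvi v hv (Or.inl rfl), hvi])
        have huR : u ∈ R := by
          have : u ∈ R.filter (G.Adj v) := by rw [heq]; simpa using hvu
          exact (Finset.mem_filter.1 this).1
        refine ⟨huR, le_antisymm ?_ (hx u huR)⟩
        exact (hRdeg u).trans_eq (hmem v hv hvi u huR (Or.inr hvu))) ⟨hxR, hi.symm⟩
      exact hreg i fun v => hmem v (hall v).1 (hall v).2 v (hall v).1 (Or.inl rfl))
  exact hcard.trans (by exact_mod_cast card_le_indepNum hT)

/-- The coefficients satisfy `1 / (i + 1) ≤ c i ≤ 1 / i`. -/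
theorem coeff_bounds {n : ℕ} (hn : 1 ≤ n) {c : ℕ → ℝ} (hcn : c n = 1 / (n : ℝ))
    (hrec : ∀ i : ℕ, 1 ≤ i → i ≤ n - 1 → (i : ℝ) * c i + c (i + 1) = 1) {i : ℕ} (hi : 1 ≤ i)
    (hin : i ≤ n) : 1 ≤ (i + 1) * c i ∧ i * c i ≤ 1 := by
  induction hin using Nat.decreasingInduction with
  | self =>
    have hn0 : (0 : ℝ) < n := by exact_mod_cast hn
    have : (n : ℝ) * c n = 1 := by rw [hcn]; field_simp
    have : 0 < c n := by rw [hcn]; positivity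
    constructor <;> linarith
  | of_succ k hk ih =>
    obtain ⟨h1, h2⟩ := ih (by omega)
    have hk0 : (1 : ℝ) ≤ k := by exact_mod_cast hi
    have hr := hrec k hi (by omega)
    push_cast at h1 h2
    have hpos : 0 ≤ c (k + 1) := by
      by_contra! hneg
      nlinarith
    refine ⟨?_, by linarith⟩
    have : (k : ℝ) * 1 ≤ k * ((k + 1) * c k) := by nlinarith
    exact le_of_mul_le_mul_left this (by linarith)

/-- A regular graph with one more vertex than its degree is complete. -/
theorem SimpleGraph.IsRegularOfDegree.nonempty_iso_top {V : Type*} [Fintype V] [DecidableEq V]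
    {G : SimpleGraph V} [DecidableRel G.Adj] {d : ℕ} (hreg : G.IsRegularOfDegree d)
    (hcard : Fintype.card V = d + 1) : Nonempty (G ≃g (⊤ : SimpleGraph (Fin (d + 1)))) := by
  have hadj : ∀ u v, u ≠ v → G.Adj u v := by
    intro u v huv
    have heq : G.neighborFinset u = Finset.univ.erase u := by
      refine Finset.eq_of_subset_of_card_le (fun x hx => ?_) ?_
      · exact Finset.mem_erase.2 ⟨(G.ne_of_adj ((G.mem_neighborFinset u x).1 hx)).symm,
          Finset.mem_univ x⟩
      · rw [G.card_neighborFinset_eq_degree, hreg u, Finset.card_erase_of_mem (Finset.mem_univ u),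
          Finset.card_univ, hcard, Nat.add_sub_cancel]
    rw [← G.mem_neighborFinset, heq]
    exact Finset.mem_erase.2 ⟨huv.symm, Finset.mem_univ v⟩
  refine ⟨⟨Fintype.equivFinOfCardEq hcard, fun {a b} => ?_⟩⟩
  rw [SimpleGraph.top_adj, (Fintype.equivFinOfCardEq hcard).injective.ne_iff]
  exact ⟨hadj a b, G.ne_of_adj⟩

theorem stmt5 (Δ Δ' : ℕ) (hΔ : 4 ≤ Δ)
    (c : ℕ → ℝ) (hcΔ : c Δ = 1 / (Δ : ℝ))
    (hrec : ∀ i : ℕ, 1 ≤ i → i ≤ Δ - 1 → (i : ℝ) * c i + c (i + 1) = 1)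
    {V : Type*} [Fintype V] (G : SimpleGraph V) [DecidableRel G.Adj]
    (hΔ'3 : 3 ≤ Δ') (hΔ'Δ : Δ' < Δ)
    (hconn : G.Connected) (hmax : G.maxDegree = Δ')
    (hnotK : ¬ Nonempty (G ≃g (⊤ : SimpleGraph (Fin (Δ' + 1))))) :
    ∑ i ∈ Finset.Icc 1 Δ',
      c i * ((Finset.univ.filter fun v : V => G.degree v = i).card : ℝ)
      ≤ (indepNum G : ℝ) := by
  classical
  have hbounds := @coeff_bounds Δ (by omega) c hcΔ hrec
  have hdegle : ∀ v, G.degree v ≤ Δ' := fun v => hmax ▸ G.degree_le_maxDegree v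
  have : Nonempty V := hconn.nonempty
  obtain ⟨x, hx⟩ := G.exists_maximal_degree_vertex
  have : Nontrivial V := by
    obtain ⟨y, hy⟩ := (G.degree_pos_iff_exists_adj x).1 (by omega)
    exact ⟨x, y, G.ne_of_adj hy⟩
  have hdeg1 : ∀ v, 1 ≤ G.degree v := fun v => hconn.preconnected.degree_pos_of_nontrivial v
  have hsum : ∑ i ∈ Finset.Icc 1 Δ',
      c i * ((Finset.univ.filter fun v : V => G.degree v = i).card : ℝ)
      = ∑ v, c (G.degree v) := by
    rw [← Finset.sum_fiberwise_of_maps_to (t := Finset.Icc 1 Δ') (g := fun v => G.degree v)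
      fun v _ => Finset.mem_Icc.2 ⟨hdeg1 v, hdegle v⟩]
    refine Finset.sum_congr rfl fun i _ => ?_
    rw [Finset.sum_congr rfl fun v hv => by rw [(Finset.mem_filter.1 hv).2],
      Finset.sum_const, nsmul_eq_mul, mul_comm]
  rw [hsum]
  by_cases hreg : ∃ d, G.IsRegularOfDegree d
  · obtain ⟨d, hreg⟩ := hreg
    obtain rfl : d = Δ' := by rw [← hmax, hx, hreg x]
    have hcard : d + 2 ≤ Fintype.card V := by
      have hlt := G.degree_lt_card_verts x
      rw [hreg x] at hlt
      have hne : Fintype.card V ≠ d + 1 := fun h => hnotK (hreg.nonempty_iso_top h)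
      omega
    have hindep := card_sub_one_le_mul_indepNum G hconn (by omega) hreg
    rw [Finset.sum_congr rfl fun v _ => by rw [hreg v], Finset.sum_const, nsmul_eq_mul,
      Finset.card_univ]
    have h1 := (hbounds (i := d + 1) (by omega) (by omega)).1
    have hr := hrec d (by omega) (by omega)
    have hcard' : (d : ℝ) + 2 ≤ Fintype.card V := by exact_mod_cast hcard
    push_cast at h1
    have hd0 : (0 : ℝ) < d := by exact_mod_cast (by omega : 0 < d)
    have hpos : 0 ≤ c (d + 1) := by
      by_contra! hneg
      nlinarith
    refine le_of_mul_le_mul_left ?_ hd0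
    nlinarith
  · refine sum_degree_weight_le_indepNum G hconn hdeg1 hdegle (not_exists.1 hreg) c ?_ ?_ ?_
    · simpa using (hbounds (i := 1) le_rfl (by omega)).2
    · intro i j hi hij
      induction j, hij using Nat.le_induction with
      | base => exact fun _ => le_rfl
      | succ j hij ih =>
        intro hj
        refine le_trans ?_ (ih (by omega))
        have := hrec j (by omega) (by omega)
        have := (hbounds (i := j) (by omega) (by omega)).1
        linarith
    · exact fun i hi hi' => (hrec i hi (by omega)).le
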